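/- arXiv:math/0601529 — 2 statements merged into one kernel-verified Lean document; each statement's English description precedes it below -/
import Mathlib

section
/- Let A be a unital complex C*-algebra and let a ∈ A be a selfadjoint positive invertible element, so that the spectrum of a is contained in (0, ∞). Let r > 0 be a real number strictly smaller than every element of the spectrum of a, and let s ∈ ℂ with Re s < 0. Then both Bochner integrals below converge and −(sin(πs)/π)·∫_r^∞ ρ^s (a + ρ·1)^{-1} dρ + (r/(2π))·∫_{−π}^{π} e^{it} (r e^{it})^s (a − r e^{it}·1)^{-1} dt = f(a), where f(a) denotes the continuous functional calculus of a applied to the function x ↦ x^s = exp(s·log x) on the spectrum of a. (All the resolvents appearing in the integrands are invertible: a + ρ·1 for ρ ≥ r since the spectrum of a is positive, and a − r e^{it}·1 since |r e^{it}| = r is smaller than the spectrum of a.) -/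
open MeasureTheory
open scoped Real

open Complex Set Filter Topology

lemma exp_injOn_strip {w : ℂ} {b : ℝ} (him : |w.im| ≤ π) (h : exp w = exp b) : w = b := by
  obtain ⟨n, hn⟩ := exp_eq_exp_iff_exists_int.1 h
  have him' : w.im = n * (2 * π) := by simp [hn]
  have hlt : |(n : ℝ)| < 1 := by
    rw [him', abs_mul, abs_of_pos Real.two_pi_pos] at him
    nlinarith [Real.pi_pos]
  have hn0 : n = 0 := by
    rw [← Int.abs_lt_one_iff]
    exact_mod_cast hlt
  simpa [hn0] using hn

/-- The logarithmic form of `z (z ^ s - x ^ s) / (x - z)`, for `x = exp b` and `z = exp w`, with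
the removable singularity at `w = b` filled in. -/
noncomputable def logKernel (s : ℂ) (b : ℝ) (w : ℂ) : ℂ :=
  -(exp w * dslope (fun v => exp (s * v)) b w / dslope exp b w)

lemma logKernel_eq {s : ℂ} {b : ℝ} {w : ℂ} (h : exp b ≠ exp w) :
    logKernel s b w = exp w * (exp (s * w) - exp (s * b)) * (exp b - exp w)⁻¹ := by
  have hwb : w ≠ b := fun h' => h (by rw [h'])
  have h1 : w - b ≠ 0 := sub_ne_zero.2 hwb
  have h2 : exp w - exp b ≠ 0 := sub_ne_zero.2 h.symm
  have h3 : exp b - exp w ≠ 0 := sub_ne_zero.2 h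
  rw [logKernel, dslope_of_ne _ hwb, dslope_of_ne _ hwb, slope_def_field, slope_def_field]
  field_simp
  ring

lemma differentiableAt_logKernel (s : ℂ) {b : ℝ} {w : ℂ} (him : |w.im| ≤ π) :
    DifferentiableAt ℂ (logKernel s b) w := by
  have hd {f : ℂ → ℂ} (hf : Differentiable ℂ f) : DifferentiableAt ℂ (dslope f b) w :=
    ((Complex.differentiableOn_dslope univ_mem).2 hf.differentiableOn).differentiableAt univ_mem
  have hne : dslope exp (b : ℂ) w ≠ 0 := by
    by_cases hwb : w = b
    · simp [hwb, dslope_same]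
    · rw [dslope_of_ne _ hwb, slope_def_field]
      exact div_ne_zero (sub_ne_zero.2 fun h => hwb (exp_injOn_strip him h)) (sub_ne_zero.2 hwb)
  exact ((differentiable_exp.differentiableAt.mul
    (hd (differentiable_exp.comp (differentiable_id.const_mul s)))).div
      (hd differentiable_exp) hne).neg

lemma logKernel_sub_logKernel (s : ℂ) (b u : ℝ) :
    logKernel s b (u + (-π : ℝ) * I) - logKernel s b (u + π * I) =
      2 * I * sin (π * s) * (exp (s * u) * (exp b + exp u)⁻¹ * exp u) := by
  have hpos : exp (b : ℂ) + exp u ≠ 0 := by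
    rw [← ofReal_exp, ← ofReal_exp, ← ofReal_add, ofReal_ne_zero]
    positivity
  have h1 : exp (u + π * I) = -exp u := by simp [exp_add]
  have h2 : exp (u + (-π : ℝ) * I) = -exp u := by simp [exp_add, exp_neg]
  have hne : exp (b : ℂ) ≠ -exp u := fun h => hpos (by rw [h]; ring)
  rw [logKernel_eq (by rwa [h2]), logKernel_eq (by rwa [h1]), h1, h2, sub_neg_eq_add, sin]
  have e1 : exp (s * (u + (-π : ℝ) * I)) = exp (s * u) * exp (-(π * s) * I) := by
    rw [← exp_add]; congr 1; push_cast; ring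
  have e2 : exp (s * (u + π * I)) = exp (s * u) * exp (π * s * I) := by
    rw [← exp_add]; congr 1; ring
  rw [e1, e2]
  linear_combination (-(exp u * exp (s * u) * (exp (-(π * s) * I) - exp (π * s * I)) *
    (exp (b:ℂ) + exp u)⁻¹)) * I_sq

lemma integral_logKernel_eq (s : ℂ) (b L T : ℝ) :
    ∫ t in (-π)..π, logKernel s b (L + t * I) =
      (∫ t in (-π)..π, logKernel s b (T + t * I)) +
        2 * sin (π * s) * ∫ u in L..T, exp (s * u) * (exp b + exp u)⁻¹ * exp u := by
  have him (u t : ℝ) (ht : |t| ≤ π) : |((u : ℂ) + t * I).im| ≤ π := by simpa using ht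
  have key := integral_boundary_rect_eq_zero_of_differentiableOn (logKernel s b)
    ⟨L, -π⟩ ⟨T, π⟩ fun w hw => by
      refine (differentiableAt_logKernel s ?_).differentiableWithinAt
      have := hw.2
      rw [uIcc_of_le (by simp [Real.pi_pos.le])] at this
      exact abs_le.2 this
  have hint (t : ℝ) (ht : |t| ≤ π) :
      IntervalIntegrable (fun u : ℝ => logKernel s b (u + t * I)) volume L T :=
    Continuous.intervalIntegrable (continuous_iff_continuousAt.2 fun u =>
      ContinuousAt.comp (f := fun u : ℝ => (u : ℂ) + t * I)
        (differentiableAt_logKernel s (him u t ht)).continuousAt (by fun_prop)) _ _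
  dsimp only at key
  rw [← intervalIntegral.integral_sub (hint _ (by simp [abs_of_pos Real.pi_pos]))
    (hint _ (by simp [abs_of_pos Real.pi_pos]))] at key
  simp_rw [logKernel_sub_logKernel, intervalIntegral.integral_const_mul, smul_eq_mul] at key
  refine mul_left_cancel₀ I_ne_zero ?_
  linear_combination -key

lemma tendsto_integral_logKernel {s : ℂ} (hs : s.re < 0) (b : ℝ) :
    Tendsto (fun T : ℝ => ∫ t in (-π)..π, logKernel s b (T + t * I)) atTop
      (𝓝 (2 * π * exp (s * b))) := by
  have hexp : ∀ᶠ T : ℝ in atTop, Real.exp (b - T) ≤ 1 / 2 :=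
    (Real.tendsto_exp_atBot.comp
      (tendsto_atBot_add_const_left atTop b tendsto_neg_atTop_atBot)).eventually_le_const
        (by norm_num)
  have heq {T t : ℝ} (hT : Real.exp (b - T) ≤ 1 / 2) : logKernel s b (T + t * I) =
      (exp (s * (T + t * I)) - exp (s * b)) * (exp (b - (T + t * I)) - 1)⁻¹ := by
    have hn : ‖exp ((b : ℂ) - (T + t * I))‖ ≤ 1 / 2 := by simpa [norm_exp] using hT
    have hne : exp (b : ℂ) ≠ exp (T + t * I) := fun h => by
      rw [exp_sub, h, div_self (exp_ne_zero _), norm_one] at hn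
      norm_num at hn
    have h3 := sub_ne_zero.2 hne
    have h4 := exp_ne_zero (T + t * I)
    rw [logKernel_eq hne, exp_sub, div_sub_one h4]
    field_simp
  have hconst : (2 * π * exp (s * b) : ℂ) = ∫ _ in (-π)..π, exp (s * b) := by
    rw [intervalIntegral.integral_const, real_smul]
    push_cast
    ring
  rw [hconst]
  refine intervalIntegral.tendsto_integral_filter_of_dominated_convergence
    (fun _ => (Real.exp (|s.im| * π) + ‖exp (s * b)‖) * 2) ?_ ?_ (by simp) ?_
  · refine .of_forall fun T => ContinuousOn.aestronglyMeasurable (fun t ht => ?_)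
      measurableSet_uIoc
    refine (ContinuousAt.comp (f := fun t : ℝ => (T : ℂ) + t * I)
        (differentiableAt_logKernel s ?_).continuousAt (by fun_prop)).continuousWithinAt
    rw [uIoc_of_le (by linarith [Real.pi_pos])] at ht
    simpa using abs_le.2 ⟨ht.1.le, ht.2⟩
  · filter_upwards [hexp, eventually_ge_atTop 0] with T hT hT0
    refine .of_forall fun t ht => ?_
    rw [uIoc_of_le (by linarith [Real.pi_pos])] at ht
    rw [heq hT, norm_mul, norm_inv]
    have h1 : ‖exp (s * (T + t * I))‖ ≤ Real.exp (|s.im| * π) := by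
      rw [norm_exp, Real.exp_le_exp]
      have h2 : |s.im * t| ≤ |s.im| * π := by
        rw [abs_mul]
        gcongr
        exact abs_le.2 ⟨ht.1.le, ht.2⟩
      simp only [mul_re, add_re, ofReal_re, I_re, mul_zero, ofReal_im, I_im, mul_one, sub_self,
        add_zero, add_im, mul_im, zero_add]
      nlinarith [neg_abs_le (s.im * t), mul_nonneg (neg_nonneg.2 hs.le) hT0]
    have h2 : 1 / 2 ≤ ‖exp ((b : ℂ) - (T + t * I)) - 1‖ := by
      have hn : ‖exp ((b : ℂ) - (T + t * I))‖ ≤ 1 / 2 := by simpa [norm_exp] using hT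
      have := norm_sub_norm_le (1 : ℂ) (exp ((b : ℂ) - (T + t * I)))
      rw [norm_one, norm_sub_rev] at this
      linarith
    gcongr
    · exact (norm_sub_le _ _).trans (by gcongr)
    · rw [inv_le_comm₀ (by linarith) two_pos]
      linarith
  · refine .of_forall fun t _ => ?_
    have h1 : Tendsto (fun T : ℝ => exp (s * (T + t * I))) atTop (𝓝 0) := by
      rw [tendsto_exp_nhds_zero_iff]
      simp only [mul_re, add_re, ofReal_re, I_re, mul_zero, ofReal_im, I_im, mul_one, sub_self,
        add_zero, add_im, mul_im, zero_add]
      exact tendsto_atBot_add_const_right _ _ (tendsto_id.const_mul_atTop_of_neg hs)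
    have h2 : Tendsto (fun T : ℝ => exp ((b : ℂ) - (T + t * I))) atTop (𝓝 0) := by
      rw [tendsto_exp_nhds_zero_iff]
      simp only [sub_re, add_re, ofReal_re, mul_re, I_re, mul_zero, ofReal_im, I_im, mul_one,
        sub_self, add_zero]
      exact tendsto_atBot_add_const_left atTop b tendsto_neg_atTop_atBot
    have h3 := (h1.sub_const (exp (s * b))).mul ((h2.sub_const 1).inv₀ (by simp))
    rw [show (0 - exp (s * b)) * (0 - 1)⁻¹ = exp (s * b) by norm_num] at h3
    refine h3.congr' ?_
    filter_upwards [hexp] with T hT using (heq hT).symm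

lemma integral_circle_inv_sub {x r : ℝ} (hr : 0 < r) (hrx : r < x) :
    ∫ t in (-π)..π, exp (I * t) * ((x : ℂ) - r * exp (I * t))⁻¹ = 0 := by
  have hd : DiffContOnCl ℂ (fun z : ℂ => ((x : ℂ) - z)⁻¹) (Metric.ball 0 r) := by
    refine DifferentiableOn.diffContOnCl fun z hz => ?_
    rw [closure_ball _ hr.ne', mem_closedBall_zero_iff] at hz
    refine DifferentiableAt.differentiableWithinAt
      (((differentiableAt_const _).sub differentiableAt_id).inv (sub_ne_zero.2 ?_))
    rintro rfl
    simp [abs_of_pos (hr.trans hrx)] at hz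
    linarith
  have h := hd.circleIntegral_eq_zero hr.le
  simp only [circleIntegral, deriv_circleMap, smul_eq_mul, circleMap_zero] at h
  have hper : Function.Periodic
      (fun t : ℝ => exp (I * t) * ((x : ℂ) - r * exp (I * t))⁻¹) (2 * π) := fun t => by
    have : exp (I * ((t + 2 * π : ℝ) : ℂ)) = exp (I * t) := by
      rw [← exp_periodic (I * t)]; congr 1; push_cast; ring
    simp only [this]
  have h2 := hper.intervalIntegral_add_eq (-π) 0
  rw [show -π + 2 * π = π by ring, zero_add] at h2
  rw [h2]
  have hc : (r * I : ℂ) ≠ 0 := mul_ne_zero (by exact_mod_cast hr.ne') I_ne_zero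
  refine (mul_eq_zero.1 ?_).resolve_left hc
  rw [← intervalIntegral.integral_const_mul, ← h]
  congr 1
  ext t
  rw [mul_comm I]
  ring

lemma norm_cpow_mul_inv_add_le (s : ℂ) {z : ℂ} {ρ : ℝ} (hz : 0 ≤ z.re) (hρ : 0 < ρ) :
    ‖(ρ : ℂ) ^ s * (z + ρ)⁻¹‖ ≤ ρ ^ (s.re - 1) := by
  have h : ρ ≤ ‖z + ρ‖ := by
    refine le_trans ?_ (re_le_norm _)
    simpa using hz
  rw [norm_mul, norm_inv, norm_cpow_eq_rpow_re_of_pos hρ, Real.rpow_sub_one hρ.ne',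
    div_eq_mul_inv]
  gcongr

lemma continuousOn_cpow_mul_inv_add (s : ℂ) :
    ContinuousOn (Function.uncurry fun (ρ : ℝ) (z : ℂ) => (ρ : ℂ) ^ s * (z + ρ)⁻¹)
      (Ioi 0 ×ˢ {z | 0 ≤ z.re}) := by
  rintro ⟨ρ, z⟩ ⟨hρ, hz⟩
  simp only [mem_Ioi, mem_ofPred_eq] at hρ hz
  have h : z + ρ ≠ 0 := fun h => by
    have := congrArg re h
    simp at this
    linarith
  refine ContinuousAt.continuousWithinAt (ContinuousAt.mul ?_ (ContinuousAt.inv₀ (by fun_prop) h))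
  exact ContinuousAt.comp (g := fun t : ℝ => (t : ℂ) ^ s) (f := Prod.fst) (x := (ρ, z))
    (continuousAt_ofReal_cpow_const ρ s (.inr hρ.ne')) continuousAt_fst

lemma integral_keyhole {x r : ℝ} (hr : 0 < r) (hrx : r < x) {s : ℂ} (hs : s.re < 0) :
    -(sin (π * s) / π) * (∫ ρ in Ioi r, (ρ : ℂ) ^ s * ((x : ℂ) + ρ)⁻¹) +
      (r / (2 * π)) * (∫ t in (-π)..π, exp (I * t) * exp (s * (Real.log r + t * I)) *
        ((x : ℂ) - r * exp (I * t))⁻¹) = (x : ℂ) ^ s := by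
  have hx : 0 < x := hr.trans hrx
  set b := Real.log x with hb
  set L := Real.log r with hL
  have hbx : exp (b : ℂ) = x := by rw [← ofReal_exp, hb, Real.exp_log hx]
  have hLr : exp (L : ℂ) = r := by rw [← ofReal_exp, hL, Real.exp_log hr]
  have hne (t : ℝ) : (x : ℂ) - r * exp (I * t) ≠ 0 := sub_ne_zero.2 fun h => by
    have := congrArg norm h
    simp [mul_comm I, norm_exp, abs_of_pos hr, abs_of_pos hx] at this
    linarith
  have hint : IntegrableOn (fun ρ : ℝ => (ρ : ℂ) ^ s * ((x : ℂ) + ρ)⁻¹) (Ioi r) := by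
    refine (integrableOn_Ioi_rpow_of_lt (a := s.re - 1) (by linarith) hr).mono' ?_ ?_
    · refine ContinuousOn.aestronglyMeasurable ?_ measurableSet_Ioi
      exact (continuousOn_cpow_mul_inv_add s).comp (f := fun ρ : ℝ => (ρ, (x : ℂ)))
        (by fun_prop) fun ρ hρ => ⟨hr.trans hρ, by simpa using hx.le⟩
    · exact ae_restrict_of_forall_mem measurableSet_Ioi fun ρ hρ =>
        norm_cpow_mul_inv_add_le s (by simpa using hx.le) (hr.trans hρ)
  have hsubst (T : ℝ) : ∫ u in L..T, exp (s * u) * (exp b + exp u)⁻¹ * exp u =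
      ∫ ρ in r..Real.exp T, (ρ : ℂ) ^ s * ((x : ℂ) + ρ)⁻¹ := by
    have h := intervalIntegral.integral_deriv_smul_comp' (a := L) (b := T) (f := Real.exp)
      (f' := Real.exp) (g := fun ρ : ℝ => (ρ : ℂ) ^ s * ((x : ℂ) + ρ)⁻¹)
      (fun u _ => Real.hasDerivAt_exp u) (by fun_prop) (by
        refine (continuousOn_cpow_mul_inv_add s).comp (f := fun ρ : ℝ => (ρ, (x : ℂ)))
          (by fun_prop) ?_
        rintro _ ⟨u, -, rfl⟩
        exact ⟨Real.exp_pos u, by simpa using hx.le⟩)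
    rw [show Real.exp L = r from Real.exp_log hr] at h
    rw [← h]
    congr 1
    ext u
    rw [Function.comp_apply, real_smul, cpow_def_of_ne_zero (by simp), ← ofReal_log (by positivity),
      Real.log_exp, hbx, ofReal_exp]
    ring_nf
  have hlim := intervalIntegral_tendsto_integral_Ioi r hint Real.tendsto_exp_atTop
  have hlim2 := (tendsto_integral_logKernel hs b).add (hlim.const_mul (2 * sin (π * s)))
  simp_rw [← hsubst, ← integral_logKernel_eq] at hlim2
  have hK := tendsto_nhds_unique tendsto_const_nhds hlim2
  have hsplit : ∫ t in (-π)..π, logKernel s b (L + t * I) =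
      r * ∫ t in (-π)..π, exp (I * t) * exp (s * (L + t * I)) *
        ((x : ℂ) - r * exp (I * t))⁻¹ := by
    have h0 := integral_circle_inv_sub hr hrx
    have hI1 : IntervalIntegrable (fun t : ℝ => exp (I * t) * exp (s * (L + t * I)) *
        ((x : ℂ) - r * exp (I * t))⁻¹) volume (-π) π :=
      Continuous.intervalIntegrable (Continuous.mul (by fun_prop)
        (Continuous.inv₀ (by fun_prop) hne)) _ _
    have hI2 : IntervalIntegrable (fun t : ℝ => exp (I * t) *
        ((x : ℂ) - r * exp (I * t))⁻¹) volume (-π) π :=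
      Continuous.intervalIntegrable (Continuous.mul (by fun_prop)
        (Continuous.inv₀ (by fun_prop) hne)) _ _
    have h1 := intervalIntegral.integral_sub hI1 (hI2.const_mul (exp (s * b)))
    rw [intervalIntegral.integral_const_mul, h0, mul_zero, sub_zero] at h1
    rw [← h1, ← intervalIntegral.integral_const_mul]
    congr 1
    ext t
    have he : exp (L + t * I) = r * exp (I * t) := by rw [exp_add, hLr, mul_comm I]
    rw [logKernel_eq (by rw [he, hbx]; exact sub_ne_zero.1 (hne t)), he, hbx]
    ring
  rw [hsplit] at hK
  have hxs : (x : ℂ) ^ s = exp (s * b) := by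
    rw [cpow_def_of_ne_zero (by exact_mod_cast hx.ne'), ← ofReal_log hx.le, mul_comm]
  have hpi : (π : ℂ) ≠ 0 := by exact_mod_cast Real.pi_ne_zero
  rw [hxs, div_mul_eq_mul_div, hK]
  field_simp
  ring

lemma continuousOn_setIntegral_of_dominated {S : Set ℝ} (hS : MeasurableSet S)
    {f : ℝ → ℂ → ℂ} {K : Set ℂ} {bound : ℝ → ℝ}
    (hf : ContinuousOn (Function.uncurry f) (S ×ˢ K))
    (hbound : ∀ t ∈ S, ∀ z ∈ K, ‖f t z‖ ≤ bound t) (hint : IntegrableOn bound S) :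
    ContinuousOn (fun z => ∫ t in S, f t z) K := by
  refine continuousOn_of_dominated (bound := bound) (fun z hz => ?_) (fun z hz => ?_) hint ?_
  · exact (hf.comp (f := fun t : ℝ => (t, z)) (by fun_prop)
      fun t ht => ⟨ht, hz⟩).aestronglyMeasurable hS
  · exact ae_restrict_of_forall_mem hS fun t ht => hbound t ht z hz
  · exact ae_restrict_of_forall_mem hS fun t ht =>
      hf.comp (f := fun z : ℂ => (t, z)) (by fun_prop) fun z hz => ⟨ht, hz⟩

section Resolvent

variable {A : Type*} [CStarAlgebra A]

lemma isUnit_sub_smul_one {a : A} {μ : ℂ} (h : μ ∉ spectrum ℂ a) : IsUnit (a - μ • (1 : A)) := by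
  rw [spectrum.notMem_iff, Algebra.algebraMap_eq_smul_one] at h
  simpa using h.neg

lemma smul_inverse_sub_smul_one {a : A} [IsStarNormal a] (c : ℂ) {μ : ℂ}
    (h : μ ∉ spectrum ℂ a) :
    c • Ring.inverse (a - μ • (1 : A)) = cfc (fun z : ℂ => c * (z - μ)⁻¹) a := by
  have hne : ∀ z ∈ spectrum ℂ a, z - μ ≠ 0 := fun z hz h0 => h (sub_eq_zero.1 h0 ▸ hz)
  rw [cfc_const_mul c (fun z => (z - μ)⁻¹) a (ContinuousOn.inv₀ (by fun_prop) hne), cfc_inv _ a hne,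
    cfc_sub _ _ a, cfc_id' ℂ a, cfc_const μ a, Algebra.algebraMap_eq_smul_one]

lemma IsSelfAdjoint.re_mem_spectrum {a : A} (ha : IsSelfAdjoint a) {z : ℂ}
    (hz : z ∈ spectrum ℂ a) : z.re ∈ spectrum ℝ a := by
  rw [ha.mem_spectrum_eq_re hz] at hz
  exact spectrum.of_algebraMap_mem ℂ hz

end Resolvent

/-- Operator-theoretic content of Seeley's formula `P^s = (i/2π) ∫_{Γ_r} λ^s (P-λ)⁻¹ dλ`
in a unital C*-algebra: for a selfadjoint positive invertible element `a` with spectrum in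
`(0,∞)`, `0 < r` below the spectrum of `a`, and `Re s < 0`, all the resolvents in the
integrands are invertible, both Bochner integrals converge, and the explicitly
parametrized keyhole contour integral equals the continuous functional calculus of `a`
applied to `z ↦ z^s`. -/
theorem stmt1 {A : Type*} [CStarAlgebra A]
    (a : A) (ha : IsSelfAdjoint a) (ha_inv : IsUnit a)
    (hspec : spectrum ℝ a ⊆ Set.Ioi (0 : ℝ))
    (r : ℝ) (hr : 0 < r) (hrspec : ∀ x ∈ spectrum ℝ a, r < x)
    (s : ℂ) (hs : s.re < 0) :
    (∀ ρ : ℝ, r ≤ ρ → IsUnit (a + (ρ : ℂ) • (1 : A))) ∧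
    (∀ t : ℝ, IsUnit (a - ((r : ℂ) * Complex.exp (Complex.I * t)) • (1 : A))) ∧
    IntegrableOn
      (fun ρ : ℝ => (ρ : ℂ) ^ s • Ring.inverse (a + (ρ : ℂ) • (1 : A))) (Set.Ioi r) ∧
    IntervalIntegrable
      (fun t : ℝ =>
        (Complex.exp (Complex.I * t) * ((r : ℂ) * Complex.exp (Complex.I * t)) ^ s) •
          Ring.inverse (a - ((r : ℂ) * Complex.exp (Complex.I * t)) • (1 : A)))
      volume (-π) π ∧
    (-(Complex.sin ((π : ℂ) * s) / (π : ℂ))) •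
        (∫ ρ in Set.Ioi r, (ρ : ℂ) ^ s • Ring.inverse (a + (ρ : ℂ) • (1 : A)))
      + ((r : ℂ) / (2 * (π : ℂ))) •
        (∫ t in (-π : ℝ)..π,
          (Complex.exp (Complex.I * t) * ((r : ℂ) * Complex.exp (Complex.I * t)) ^ s) •
            Ring.inverse (a - ((r : ℂ) * Complex.exp (Complex.I * t)) • (1 : A)))
      = cfc (fun z : ℂ => z ^ s) a := by
  have : IsStarNormal a := ha.isStarNormal
  have hre : ∀ z ∈ spectrum ℂ a, z = (z.re : ℂ) ∧ r < z.re := fun z hz =>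
    ⟨ha.mem_spectrum_eq_re hz, hrspec _ (ha.re_mem_spectrum hz)⟩
  have hray {ρ : ℝ} (hρ : r ≤ ρ) : (-ρ : ℂ) ∉ spectrum ℂ a := fun h => by
    have := (hre _ h).2
    simp only [neg_re, ofReal_re] at this
    linarith
  have hcirc (t : ℝ) : (r : ℂ) * exp (I * t) ∉ spectrum ℂ a := fun h => by
    have h1 := (hre _ h).2.trans_le (re_le_norm _)
    simp [mul_comm I, norm_exp, abs_of_pos hr] at h1
  have hpi : -π ≤ π := by linarith [Real.pi_pos]
  set f : ℝ → ℂ → ℂ := fun ρ z => (ρ : ℂ) ^ s * (z + ρ)⁻¹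
  set g : ℝ → ℂ → ℂ := fun t z =>
    exp (I * t) * exp (s * (Real.log r + t * I)) * (z - r * exp (I * t))⁻¹
  have hf_eq {ρ : ℝ} (hρ : r ≤ ρ) :
      (ρ : ℂ) ^ s • Ring.inverse (a + (ρ : ℂ) • (1 : A)) = cfc (f ρ) a := by
    have := smul_inverse_sub_smul_one ((ρ : ℂ) ^ s) (hray hρ)
    simpa only [neg_smul, sub_neg_eq_add] using this
  have hg_eq {t : ℝ} (ht : t ∈ Ioc (-π) π) :
      (exp (I * t) * ((r : ℂ) * exp (I * t)) ^ s) •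
        Ring.inverse (a - ((r : ℂ) * exp (I * t)) • (1 : A)) = cfc (g t) a := by
    have he : (r : ℂ) * exp (I * t) = exp (Real.log r + t * I) := by
      rw [exp_add, ← ofReal_exp, Real.exp_log hr, mul_comm I]
    have hpow : ((r : ℂ) * exp (I * t)) ^ s = exp (s * (Real.log r + t * I)) := by
      rw [he, cpow_def_of_ne_zero (exp_ne_zero _),
        log_exp (by simpa using ht.1) (by simpa using ht.2), mul_comm]
    rw [smul_inverse_sub_smul_one _ (hcirc t), hpow]
  have hf_cont : ContinuousOn (Function.uncurry f) (Ioi r ×ˢ spectrum ℂ a) :=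
    (continuousOn_cpow_mul_inv_add s).mono
      (prod_mono (Ioi_subset_Ioi hr.le) fun z hz => (hr.trans (hre z hz).2).le)
  have hf_bound : ∀ ρ ∈ Ioi r, ∀ z ∈ spectrum ℂ a, ‖f ρ z‖ ≤ ρ ^ (s.re - 1) :=
    fun ρ hρ z hz => norm_cpow_mul_inv_add_le s (hr.trans (hre z hz).2).le (hr.trans hρ)
  have hf_int : IntegrableOn (fun ρ : ℝ => ρ ^ (s.re - 1)) (Ioi r) :=
    integrableOn_Ioi_rpow_of_lt (by linarith) hr
  have hg_cont_univ : ContinuousOn (Function.uncurry g) (univ ×ˢ spectrum ℂ a) := by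
    refine ContinuousOn.mul (by fun_prop) (ContinuousOn.inv₀ (by fun_prop) ?_)
    rintro ⟨t, z⟩ ⟨-, hz⟩ h0
    exact hcirc t (sub_eq_zero.1 h0 ▸ hz)
  have hg_cont : ContinuousOn (Function.uncurry g) (Ioc (-π) π ×ˢ spectrum ℂ a) :=
    hg_cont_univ.mono (prod_mono (subset_univ _) subset_rfl)
  obtain ⟨C, hC⟩ := (isCompact_Icc.prod (spectrum.isCompact a)).exists_bound_of_continuousOn
    (hg_cont_univ.mono (prod_mono (subset_univ (Icc (-π) π)) subset_rfl))
  have hg_bound : ∀ t ∈ Ioc (-π) π, ∀ z ∈ spectrum ℂ a, ‖g t z‖ ≤ C :=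
    fun t ht z hz => hC (t, z) ⟨Ioc_subset_Icc_self ht, hz⟩
  have hg_int : IntegrableOn (fun _ : ℝ => C) (Ioc (-π) π) := by simp
  refine ⟨fun ρ hρ => by simpa using isUnit_sub_smul_one (hray hρ),
    fun t => isUnit_sub_smul_one (hcirc t), ?_, ?_, ?_⟩
  · refine (integrableOn_congr_fun (fun ρ hρ => hf_eq (le_of_lt hρ)) measurableSet_Ioi).2 ?_
    exact integrableOn_cfc measurableSet_Ioi f _ a hf_cont
      (ae_restrict_of_forall_mem measurableSet_Ioi hf_bound) hf_int.hasFiniteIntegral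
  · rw [intervalIntegrable_iff_integrableOn_Ioc_of_le hpi]
    refine (integrableOn_congr_fun (fun t ht => hg_eq ht) measurableSet_Ioc).2 ?_
    exact integrableOn_cfc measurableSet_Ioc g _ a hg_cont
      (ae_restrict_of_forall_mem measurableSet_Ioc hg_bound) hg_int.hasFiniteIntegral
  · rw [intervalIntegral.integral_of_le hpi,
      setIntegral_congr_fun measurableSet_Ioi fun ρ hρ => hf_eq (le_of_lt hρ),
      setIntegral_congr_fun measurableSet_Ioc fun t ht => hg_eq ht,
      ← cfc_setIntegral measurableSet_Ioi f _ a hf_cont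
        (ae_restrict_of_forall_mem measurableSet_Ioi hf_bound) hf_int.hasFiniteIntegral,
      ← cfc_setIntegral measurableSet_Ioc g _ a hg_cont
        (ae_restrict_of_forall_mem measurableSet_Ioc hg_bound) hg_int.hasFiniteIntegral]
    have hF := continuousOn_setIntegral_of_dominated measurableSet_Ioi hf_cont hf_bound hf_int
    have hG := continuousOn_setIntegral_of_dominated measurableSet_Ioc hg_cont hg_bound hg_int
    rw [← cfc_const_mul _ _ a hF, ← cfc_const_mul _ _ a hG,
      ← cfc_add a _ _ (hF.const_mul _) (hG.const_mul _)]
    refine cfc_congr fun z hz => ?_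
    obtain ⟨hz1, hz2⟩ := hre z hz
    have := integral_keyhole hr hz2 hs
    rw [← hz1, intervalIntegral.integral_of_le hpi] at this
    exact this
end

section
/- Let V be a real vector space of finite dimension 2n with n ≥ 1, and let ω be an element of the second exterior power ⋀²V, viewed inside the exterior algebra ⋀V, such that the n-fold product ω ∧ ⋯ ∧ ω (n factors) is nonzero in ⋀^{2n}V. Then the linear map from ⋀^{n−1} V to ⋀^{n+1} V given by x ↦ ω ∧ x is bijective. -/
open CliffordAlgebra (contractLeft contractLeft_ι_mul contractLeft_algebraMap contractLeft_ι)

section ExteriorContraction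

variable {R M : Type*} [CommRing R] [AddCommGroup M] [Module R M]

namespace ExteriorAlgebra

theorem commute_of_mem_exteriorPower_two {ω : ExteriorAlgebra R M} (hω : ω ∈ ⋀[R]^2 M)
    (x : ExteriorAlgebra R M) : Commute ω x := by
  have hι (v : M) : Commute ω (ι R v) := by
    rw [exteriorPower, pow_two] at hω
    induction hω using Submodule.mul_induction_on' with
    | mem_mul_mem a ha b hb =>
      obtain ⟨a, rfl⟩ := ha
      obtain ⟨b, rfl⟩ := hb
      have h₁ := eq_neg_of_add_eq_zero_left (ι_add_mul_swap (R := R) b v)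
      have h₂ := eq_neg_of_add_eq_zero_left (ι_add_mul_swap (R := R) a v)
      rw [Commute, SemiconjBy, mul_assoc, h₁, mul_neg, ← mul_assoc, h₂, neg_mul, neg_neg, mul_assoc]
    | add a _ b _ ha hb => exact ha.add_left hb
  induction x using ExteriorAlgebra.induction with
  | algebraMap r => exact Algebra.commute_algebraMap_right r ω
  | ι v => exact hι v
  | mul a b ha hb => exact ha.mul_right hb
  | add a b ha hb => exact ha.add_right hb

theorem contractLeft_mul_of_mem_exteriorPower_two (d : Module.Dual R M)
    {ω : ExteriorAlgebra R M} (hω : ω ∈ ⋀[R]^2 M) (x : ExteriorAlgebra R M) :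
    contractLeft d (ω * x) = contractLeft d ω * x + ω * contractLeft d x := by
  rw [exteriorPower, pow_two] at hω
  induction hω using Submodule.mul_induction_on' with
  | mem_mul_mem a ha b hb =>
    obtain ⟨a, rfl⟩ := ha
    obtain ⟨b, rfl⟩ := hb
    simp only [mul_assoc, contractLeft_ι_mul, contractLeft_ι, mul_sub, sub_mul,
      mul_smul_comm, smul_mul_assoc, ← Algebra.commutes, ← Algebra.smul_def]
    abel
  | add a _ b _ ha hb => simp only [add_mul, map_add, ha, hb]; abel

theorem exists_contractLeft_pow_mul (d : Module.Dual R M)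
    {ω : ExteriorAlgebra R M} (hω : ω ∈ ⋀[R]^2 M) (k : ℕ) (x : ExteriorAlgebra R M) :
    ∃ c, contractLeft d (ω ^ (k + 1) * x) = c * (ω ^ k * x) + ω ^ (k + 1) * contractLeft d x := by
  induction k with
  | zero => exact ⟨contractLeft d ω, by
      simpa using contractLeft_mul_of_mem_exteriorPower_two d hω x⟩
  | succ k ih =>
    obtain ⟨c, hc⟩ := ih
    refine ⟨contractLeft d ω + c, ?_⟩
    rw [pow_succ' ω (k + 1), mul_assoc, contractLeft_mul_of_mem_exteriorPower_two d hω, hc,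
      mul_add, ← mul_assoc ω c, (commute_of_mem_exteriorPower_two hω c).eq, pow_succ' ω k]
    simp only [add_mul, mul_assoc, add_assoc]

theorem contractLeft_mem_exteriorPower (d : Module.Dual R M) {k : ℕ}
    {x : ExteriorAlgebra R M} (hx : x ∈ ⋀[R]^(k + 1) M) : contractLeft d x ∈ ⋀[R]^k M := by
  induction k generalizing x with
  | zero =>
    rw [zero_add, exteriorPower, pow_one] at hx
    obtain ⟨v, rfl⟩ := hx
    rw [contractLeft_ι, exteriorPower, pow_zero]
    exact Submodule.algebraMap_mem _
  | succ k ih =>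
    rw [exteriorPower, pow_succ'] at hx
    induction hx using Submodule.mul_induction_on' with
    | mem_mul_mem a ha b hb =>
      obtain ⟨a, rfl⟩ := ha
      rw [contractLeft_ι_mul]
      refine sub_mem (Submodule.smul_mem _ _ hb) ?_
      rw [exteriorPower, pow_succ']
      exact Submodule.mul_mem_mul ⟨a, rfl⟩ (ih hb)
    | add a _ b _ ha hb => rw [map_add]; exact add_mem ha hb

theorem sum_ι_mul_contractLeft_coord {I : Type*} [Fintype I] (b : Module.Basis I R M) {k : ℕ}
    {x : ExteriorAlgebra R M} (hx : x ∈ ⋀[R]^k M) :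
    ∑ i, ι R (b i) * contractLeft (b.coord i) x = k • x := by
  induction k generalizing x with
  | zero =>
    rw [exteriorPower, pow_zero] at hx
    obtain ⟨r, rfl⟩ := Submodule.mem_one.mp hx
    simp [contractLeft_algebraMap]
  | succ k ih =>
    rw [exteriorPower, pow_succ'] at hx
    induction hx using Submodule.mul_induction_on' with
    | mem_mul_mem a ha y hy =>
      obtain ⟨a, rfl⟩ := ha
      have hswap (i : I) : ι R (b i) * contractLeft (b.coord i) (ι R a * y) =
          ι R (b.coord i a • b i) * y + ι R a * (ι R (b i) * contractLeft (b.coord i) y) := by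
        have h := eq_neg_of_add_eq_zero_left (ι_add_mul_swap (R := R) (b i) a)
        rw [contractLeft_ι_mul, mul_sub, ← mul_assoc (ι R (b i)) (ι R a), h, map_smul,
          mul_smul_comm, smul_mul_assoc, neg_mul, sub_neg_eq_add, mul_assoc]
      have hsum : ∑ i, b.coord i a • b i = a := b.sum_repr a
      rw [Finset.sum_congr rfl fun i _ => hswap i, Finset.sum_add_distrib, ← Finset.sum_mul,
        ← map_sum, hsum, ← Finset.mul_sum, ih hy, mul_smul_comm, succ_nsmul']
    | add x _ y _ hx hy => simp only [map_add, mul_add, Finset.sum_add_distrib, hx, hy, smul_add]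

end ExteriorAlgebra

end ExteriorContraction

section Lefschetz

variable {K V : Type*} [Field K] [CharZero K] [AddCommGroup V] [Module K V]
  [FiniteDimensional K V]

namespace ExteriorAlgebra

theorem eq_zero_of_contractLeft_eq_zero {k : ℕ} {x : ExteriorAlgebra K V}
    (hx : x ∈ ⋀[K]^(k + 1) V) (h : ∀ d : Module.Dual K V, contractLeft d x = 0) : x = 0 := by
  have hsum := sum_ι_mul_contractLeft_coord (Module.finBasis K V) hx
  simp only [h, mul_zero, Finset.sum_const_zero, ← Nat.cast_smul_eq_nsmul K] at hsum
  exact (smul_eq_zero.mp hsum.symm).resolve_left (Nat.cast_ne_zero.mpr k.succ_ne_zero)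

/-- The injective half of the hard Lefschetz property. -/
theorem eq_zero_of_pow_mul_eq_zero {ω : ExteriorAlgebra K V} (hω : ω ∈ ⋀[K]^2 V) {k r : ℕ}
    (hnd : ω ^ (k + r) ≠ 0) {x : ExteriorAlgebra K V} (hx : x ∈ ⋀[K]^k V)
    (h : ω ^ r * x = 0) : x = 0 := by
  induction k generalizing r x with
  | zero =>
    rw [exteriorPower, pow_zero] at hx
    obtain ⟨c, rfl⟩ := Submodule.mem_one.mp hx
    rw [← Algebra.commutes, ← Algebra.smul_def] at h
    rw [zero_add] at hnd
    rw [(smul_eq_zero.mp h).resolve_right hnd, map_zero]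
  | succ k ih =>
    refine eq_zero_of_contractLeft_eq_zero hx fun d => ?_
    refine ih (r := r + 1) (by rwa [add_right_comm] at hnd)
      (contractLeft_mem_exteriorPower d hx) ?_
    obtain ⟨c, hc⟩ := exists_contractLeft_pow_mul d hω r x
    rwa [h, pow_succ', mul_assoc, h, mul_zero, map_zero, mul_zero, zero_add, ← pow_succ',
      eq_comm] at hc

end ExteriorAlgebra

end Lefschetz

/-- Lefschetz-type bijectivity in middle degree: if `V` is a real vector space of
dimension `2n` and `ω ∈ ⋀²V` satisfies `ω^n ≠ 0` (nondegeneracy), then the exterior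
multiplication `⋀^{n-1} V → ⋀^{n+1} V`, `x ↦ ω ∧ x`, is bijective. -/
theorem stmt10 (n : ℕ) (hn : 1 ≤ n) (V : Type*) [AddCommGroup V] [Module ℝ V]
    [FiniteDimensional ℝ V] (hdim : Module.finrank ℝ V = 2 * n)
    (ω : ExteriorAlgebra ℝ V) (hω : ω ∈ ⋀[ℝ]^2 V) (hnd : ω ^ n ≠ 0) :
    Set.BijOn (fun x => ω * x)
      ((⋀[ℝ]^(n - 1) V : Submodule ℝ (ExteriorAlgebra ℝ V)) : Set (ExteriorAlgebra ℝ V))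
      ((⋀[ℝ]^(n + 1) V : Submodule ℝ (ExteriorAlgebra ℝ V)) :
        Set (ExteriorAlgebra ℝ V)) := by
  obtain ⟨m, rfl⟩ : ∃ m, n = m + 1 := ⟨n - 1, by lia⟩
  rw [Nat.add_sub_cancel]
  have hmaps (x : ExteriorAlgebra ℝ V) (hx : x ∈ ⋀[ℝ]^m V) : ω * x ∈ ⋀[ℝ]^(m + 1 + 1) V := by
    rw [ExteriorAlgebra.exteriorPower, show m + 1 + 1 = 2 + m by lia, pow_add]
    exact Submodule.mul_mem_mul hω hx
  let L : ⋀[ℝ]^m V →ₗ[ℝ] ⋀[ℝ]^(m + 1 + 1) V := (LinearMap.mulLeft ℝ ω).restrict hmaps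
  have hL : Function.Injective L := by
    refine (injective_iff_map_eq_zero L).mpr fun x hx => Subtype.ext ?_
    exact ExteriorAlgebra.eq_zero_of_pow_mul_eq_zero hω hnd x.2
      ((pow_one ω).symm ▸ congrArg Subtype.val hx)
  have hrank : Module.finrank ℝ (⋀[ℝ]^m V) = Module.finrank ℝ (⋀[ℝ]^(m + 1 + 1) V) := by
    rw [exteriorPower.finrank_eq, exteriorPower.finrank_eq, hdim]
    exact Nat.choose_symm_of_eq_add (by lia)
  have hsurj := (LinearMap.injective_iff_surjective_of_finrank_eq_finrank hrank).mp hL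
  refine ⟨hmaps, fun x hx y hy hxy => ?_, fun y hy => ?_⟩
  · exact congrArg Subtype.val (hL (a₁ := ⟨x, hx⟩) (a₂ := ⟨y, hy⟩) (Subtype.ext hxy))
  · obtain ⟨x, hx⟩ := hsurj ⟨y, hy⟩
    exact ⟨x, x.2, congrArg Subtype.val hx⟩
end
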